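/- arXiv:1302.0237 — 2 statements merged into one kernel-verified Lean document; each statement's English description precedes it below -/
import Mathlib

section
/- Let R be a commutative ring and x₁,…,x_n a regular sequence generating an ideal I. Let S = R/J where J is generated by a subset of a compatible system of variables such that the images of x₁,…,x_m (m ≤ n) form a regular sequence in S and the remaining x_{m+1},…,x_n map to zero in S. Then Tor^R_k(R/I, S) ≅ Λ^k(S/IS)^{n-m} for all k, i.e. the Tor algebra is the exterior algebra on a free module of rank equal to the excess n − m. -/
/-!
STATEMENT 3: Let `R` be a commutative ring and `x₁,…,x_n` a regular sequence generating an
ideal `I`. Let `S` be a quotient `R`-algebra (i.e. `algebraMap R S` is surjective, `S = R/J`)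
such that the images of `x₁,…,x_m` (`m ≤ n`) form a regular sequence in `S` and the remaining
`x_{m+1},…,x_n` map to zero in `S`. Then `Tor^R_k(R/I, S) ≅ Λ^k((S/IS)^{n-m})` for all `k`:
the Tor algebra is the exterior algebra on a free module of rank `n - m` over `S/IS`.
-/

open CategoryTheory
open scoped TensorProduct Pointwise

section TensorComplex

variable {R : Type} [CommRing R]

/-- The complex `M ⊗ K` for a module `M` and a chain complex `K`. -/
noncomputable abbrev tensorComplex (M : Type) [AddCommGroup M] [Module R M]
    (K : ChainComplex (ModuleCat.{0} R) ℕ) : ChainComplex (ModuleCat.{0} R) ℕ :=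
  (((MonoidalCategory.tensoringLeft (ModuleCat.{0} R)).obj
    (ModuleCat.of R M)).mapHomologicalComplex _).obj K

/-- The map of complexes `M ⊗ K ⟶ N ⊗ K` induced by a linear map `M → N`. -/
noncomputable abbrev tensorComplexMap {M N : Type} [AddCommGroup M] [Module R M]
    [AddCommGroup N] [Module R N] (f : M →ₗ[R] N)
    (K : ChainComplex (ModuleCat.{0} R) ℕ) : tensorComplex M K ⟶ tensorComplex N K :=
  (NatTrans.mapHomologicalComplex
    ((MonoidalCategory.tensoringLeft (ModuleCat.{0} R)).map (ModuleCat.ofHom f)) _).app K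

lemma tensorComplexMap_f {M N : Type} [AddCommGroup M] [Module R M]
    [AddCommGroup N] [Module R N] (f : M →ₗ[R] N)
    (K : ChainComplex (ModuleCat.{0} R) ℕ) (i : ℕ) :
    (tensorComplexMap f K).f i = ModuleCat.ofHom (f.rTensor (K.X i)) := rfl

lemma tensorComplexMap_smul_id {M : Type} [AddCommGroup M] [Module R M] (r : R)
    (K : ChainComplex (ModuleCat.{0} R) ℕ) :
    tensorComplexMap (r • LinearMap.id : M →ₗ[R] M) K = r • 𝟙 _ := by
  ext i : 1
  rw [tensorComplexMap_f, LinearMap.rTensor_smul, LinearMap.rTensor_id]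
  rfl

lemma homologyMap_smul_id (L : ChainComplex (ModuleCat.{0} R) ℕ) (r : R) (k : ℕ) :
    HomologicalComplex.homologyMap (r • 𝟙 L) k = r • 𝟙 _ := by
  have := ShortComplex.homologyMap_smul
    ((HomologicalComplex.shortComplexFunctor (ModuleCat.{0} R) _ k).map (𝟙 L)) r
  refine Eq.trans this ?_
  congr 1
  exact HomologicalComplex.homologyMap_id L k

lemma smul_homology_eq_zero {L : ChainComplex (ModuleCat.{0} R) ℕ} {r : R} {k : ℕ}
    (h : HomologicalComplex.homologyMap (r • 𝟙 L) k = 0) (z : L.homology k) : r • z = 0 := by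
  rw [homologyMap_smul_id] at h
  exact LinearMap.congr_fun (ModuleCat.hom_ext_iff.mp h) z

lemma smul_homology_tensorComplex_eq_zero_of_left {M : Type} [AddCommGroup M] [Module R M]
    {r : R} (hr : ∀ m : M, r • m = 0) (K : ChainComplex (ModuleCat.{0} R) ℕ) (k : ℕ)
    (z : (tensorComplex M K).homology k) : r • z = 0 := by
  refine smul_homology_eq_zero ?_ z
  have h0 : (r • LinearMap.id : M →ₗ[R] M) = 0 := LinearMap.ext hr
  have : r • 𝟙 (tensorComplex M K) = 0 := by
    rw [← tensorComplexMap_smul_id, h0]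
    ext i : 1
    rw [tensorComplexMap_f, LinearMap.rTensor_zero]
    rfl
  rw [this, HomologicalComplex.homologyMap_zero]

lemma smul_homology_tensorComplex_eq_zero_of_right {M N : Type} [AddCommGroup M] [Module R M]
    [AddCommGroup N] [Module R N] (P : ProjectiveResolution (ModuleCat.of R N))
    {r : R} (hr : ∀ n : N, r • n = 0) (k : ℕ)
    (z : (tensorComplex M P.complex).homology k) : r • z = 0 := by
  refine smul_homology_eq_zero ?_ z
  have h0 : r • 𝟙 (ModuleCat.of R N) = 0 := by
    ext n
    exact hr n
  have hN : P.π ≫ (ChainComplex.single₀ _).map (r • 𝟙 (ModuleCat.of R N)) = r • P.π := by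
    apply HomologicalComplex.to_single_hom_ext
    ext x
    simp
    rfl
  have h : Homotopy (r • 𝟙 P.complex) 0 :=
    ProjectiveResolution.liftHomotopy (0 : ModuleCat.of R N ⟶ ModuleCat.of R N) _ _
      (by rw [← h0, hN]; simp) (by simp)
  have h' := (((MonoidalCategory.tensoringLeft (ModuleCat.{0} R)).obj
    (ModuleCat.of R M)).mapHomotopy h).homologyMap_eq k
  simpa [Functor.map_smul] using h'

lemma shortExact_tensorComplex {M₁ M₂ M₃ : Type} [AddCommGroup M₁] [Module R M₁]
    [AddCommGroup M₂] [Module R M₂] [AddCommGroup M₃] [Module R M₃]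
    {f : M₁ →ₗ[R] M₂} {g : M₂ →ₗ[R] M₃} (hf : Function.Injective f)
    (hfg : Function.Exact f g) (hg : Function.Surjective g)
    (K : ChainComplex (ModuleCat.{0} R) ℕ) [∀ i, Projective (K.X i)] :
    ∃ h, (ShortComplex.mk (tensorComplexMap f K) (tensorComplexMap g K) h).ShortExact := by
  refine ⟨?_, HomologicalComplex.shortExact_of_degreewise_shortExact _ fun i => ?_⟩
  · ext i : 1
    refine ModuleCat.hom_ext ?_
    change g.rTensor (K.X i) ∘ₗ f.rTensor (K.X i) = 0
    rw [← LinearMap.rTensor_comp, hfg.linearMap_comp_eq_zero, LinearMap.rTensor_zero]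
  · have : Module.Projective R (K.X i) := (IsProjective.iff_projective (K.X i)).mpr
      (inferInstanceAs (Projective (K.X i)))
    refine ModuleCat.shortComplex_shortExact _ ?_ ?_ ?_
    · exact rTensor_exact (K.X i) hfg hg
    · exact Module.Flat.rTensor_preserves_injective_linearMap f hf
    · exact LinearMap.rTensor_surjective _ hg

/-- The long exact homology sequence attached to multiplication by a regular element. -/
lemma exists_homology_tensorComplex_exact {M : Type} [AddCommGroup M] [Module R M] {r : R}
    (hr : IsSMulRegular M r) (K : ChainComplex (ModuleCat.{0} R) ℕ) [∀ i, Projective (K.X i)] :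
    ∃ (p : ∀ k, (tensorComplex M K).homology k →ₗ[R]
        (tensorComplex (QuotSMulTop r M) K).homology k)
      (d : ∀ k, (tensorComplex (QuotSMulTop r M) K).homology (k + 1) →ₗ[R]
        (tensorComplex M K).homology k),
      (∀ k, Function.Exact (fun z : (tensorComplex M K).homology k => r • z) (p k)) ∧
      (∀ k, Function.Exact (p (k + 1)) (d k)) ∧
      (∀ k, Function.Exact (d k) (fun z : (tensorComplex M K).homology k => r • z)) ∧
      Function.Surjective (p 0) := by
  have hinj : Function.Injective (r • LinearMap.id : M →ₗ[R] M) := hr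
  have hex : Function.Exact (r • LinearMap.id : M →ₗ[R] M)
      (Submodule.mkQ (r • ⊤ : Submodule R M)) := by
    intro m
    rw [Submodule.mkQ_apply, Submodule.Quotient.mk_eq_zero, Submodule.mem_smul_pointwise_iff_exists]
    simp
  obtain ⟨h0, hS⟩ := shortExact_tensorComplex hinj hex (Submodule.mkQ_surjective _) K
  have hmap (k : ℕ) : ⇑(HomologicalComplex.homologyMap
      (tensorComplexMap (r • LinearMap.id : M →ₗ[R] M) K) k).hom = fun z => r • z := by
    rw [tensorComplexMap_smul_id, homologyMap_smul_id]
    rfl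
  refine ⟨fun k => (HomologicalComplex.homologyMap (tensorComplexMap (Submodule.mkQ _) K) k).hom,
    fun k => (hS.δ (k + 1) k (by simp)).hom, fun k => ?_, fun k => ?_, fun k => ?_, ?_⟩
  · have h := (ShortComplex.ShortExact.moduleCat_exact_iff_function_exact _).mp
      (hS.homology_exact₂ k)
    exact (hmap k) ▸ h
  · exact (ShortComplex.ShortExact.moduleCat_exact_iff_function_exact _).mp
      (hS.homology_exact₃ (k + 1) k (by simp))
  · have h := (ShortComplex.ShortExact.moduleCat_exact_iff_function_exact _).mp
      (hS.homology_exact₁ (k + 1) k (by simp))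
    exact (hmap k) ▸ h
  · rw [← ModuleCat.epi_iff_surjective]
    have := hS.epi_g
    exact HomologicalComplex.epi_homologyMap_of_epi_of_not_rel
      (tensorComplexMap (Submodule.mkQ _) K) 0 (by simp)


/-- `Tor` is computed by tensoring with any projective resolution of the second argument. -/
noncomputable def torEquivHomology {M N : Type} [AddCommGroup M] [Module R M]
    [AddCommGroup N] [Module R N] (P : ProjectiveResolution (ModuleCat.of R N)) (k : ℕ) :
    ((Tor (ModuleCat R) k).obj (ModuleCat.of R M)).obj (ModuleCat.of R N) ≃ₗ[R]
      (tensorComplex M P.complex).homology k :=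
  (P.isoLeftDerivedObj ((MonoidalCategory.tensoringLeft (ModuleCat.{0} R)).obj
    (ModuleCat.of R M)) k).toLinearEquiv

/-- The zeroth homology of `M ⊗ P` is `M ⊗ N` for a projective resolution `P` of `N`. -/
noncomputable def homologyZeroEquivTensor {M N : Type} [AddCommGroup M] [Module R M]
    [AddCommGroup N] [Module R N] (P : ProjectiveResolution (ModuleCat.of R N)) :
    (tensorComplex M P.complex).homology 0 ≃ₗ[R] M ⊗[R] N :=
  haveI : Limits.PreservesFiniteColimits ((MonoidalCategory.tensoringLeft (ModuleCat.{0} R)).obj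
    (ModuleCat.of R M)) :=
    inferInstanceAs (Limits.PreservesFiniteColimits
      (MonoidalCategory.tensorLeft (ModuleCat.of R M)))
  (torEquivHomology P 0).symm ≪≫ₗ
    (((MonoidalCategory.tensoringLeft (ModuleCat.{0} R)).obj
      (ModuleCat.of R M)).leftDerivedZeroIsoSelf.app (ModuleCat.of R N)).toLinearEquiv

/-- The homology of `M ⊗ P` only depends on `M` up to linear equivalence. -/
noncomputable def homologyTensorComplexCongr {M M' N : Type} [AddCommGroup M] [Module R M]
    [AddCommGroup M'] [Module R M'] [AddCommGroup N] [Module R N]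
    (P : ProjectiveResolution (ModuleCat.of R N)) (e : M ≃ₗ[R] M') (k : ℕ) :
    (tensorComplex M P.complex).homology k ≃ₗ[R] (tensorComplex M' P.complex).homology k :=
  (torEquivHomology P k).symm ≪≫ₗ
    (((Tor (ModuleCat R) k).mapIso e.toModuleIso).app (ModuleCat.of R N)).toLinearEquiv ≪≫ₗ
    torEquivHomology P k

/-- `M ⧸ (0)M ≃ M`, with the zero ideal written as the span of the empty list. -/
noncomputable def quotientOfListNilEquiv (M : Type) [AddCommGroup M] [Module R M] :
    (M ⧸ (Ideal.ofList ([] : List R) • ⊤ : Submodule R M)) ≃ₗ[R] M :=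
  Submodule.quotEquivOfEqBot _ (by rw [Ideal.ofList_nil, Submodule.bot_smul])

lemma subsingleton_homology_tensorComplex_self {N : Type} [AddCommGroup N] [Module R N]
    (P : ProjectiveResolution (ModuleCat.of R N)) (k : ℕ) :
    Subsingleton ((tensorComplex R P.complex).homology (k + 1)) := by
  let e : tensorComplex R P.complex ≅ P.complex :=
    ((NatIso.mapHomologicalComplex (MonoidalCategory.leftUnitorNatIso (ModuleCat.{0} R)) _) ≪≫
      Functor.mapHomologicalComplexIdIso _ _).app P.complex
  exact ModuleCat.subsingleton_of_isZero
    ((P.complex_exactAt_succ k).of_iso e.symm).isZero_homology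

lemma subsingleton_homology_quotSMulTop {M N : Type} [AddCommGroup M] [Module R M]
    [AddCommGroup N] [Module R N] (P : ProjectiveResolution (ModuleCat.of R N))
    (hH : ∀ k, Subsingleton ((tensorComplex M P.complex).homology (k + 1))) {r : R}
    (hr : IsSMulRegular M r) (hrN : IsSMulRegular (M ⊗[R] N) r) (k : ℕ) :
    Subsingleton ((tensorComplex (QuotSMulTop r M) P.complex).homology (k + 1)) := by
  obtain ⟨p, d, -, hpd, hd, -⟩ := exists_homology_tensorComplex_exact hr P.complex
  have hd0 : ∀ z, d k z = 0 := by
    intro z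
    obtain _ | k := k
    · have h : r • d 0 z = 0 := (hd 0).apply_apply_eq_zero z
      have hreg := (homologyZeroEquivTensor (M := M) P).isSMulRegular_congr r
      exact (hreg.mpr hrN).right_eq_zero_of_smul h
    · exact Subsingleton.elim _ _
  refine subsingleton_of_forall_eq 0 fun z => ?_
  obtain ⟨y, rfl⟩ := (hpd k z).mp (hd0 z)
  rw [Subsingleton.elim y 0, map_zero]

lemma subsingleton_homology_quotient_ofList {N : Type} [AddCommGroup N] [Module R N]
    (P : ProjectiveResolution (ModuleCat.of R N)) (rs : List R) {M : Type} [AddCommGroup M]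
    [Module R M] (hH : ∀ k, Subsingleton ((tensorComplex M P.complex).homology (k + 1)))
    (hM : RingTheory.Sequence.IsWeaklyRegular M rs)
    (hMN : RingTheory.Sequence.IsWeaklyRegular (M ⊗[R] N) rs) (k : ℕ) :
    Subsingleton ((tensorComplex (M ⧸ (Ideal.ofList rs • ⊤ : Submodule R M))
      P.complex).homology (k + 1)) := by
  induction rs generalizing M with
  | nil =>
    exact (homologyTensorComplexCongr P (quotientOfListNilEquiv M) _).toEquiv.subsingleton_congr.mpr
      (hH k)
  | cons r rs ih =>
    rw [RingTheory.Sequence.isWeaklyRegular_cons_iff] at hM hMN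
    rw [(homologyTensorComplexCongr P (Submodule.quotOfListConsSMulTopEquivQuotSMulTopInner M r rs)
      _).toEquiv.subsingleton_congr]
    exact ih (subsingleton_homology_quotSMulTop P hH hM.1 hMN.1) hM.2
      (((QuotSMulTop.quotSMulTopTensorEquivQuotSMulTop r N M).isWeaklyRegular_congr rs).mpr hMN.2)

end TensorComplex

section Split

variable {R A : Type*} [CommRing R] [CommRing A] [Algebra R A]

lemma nonempty_linearEquiv_prod_of_exact (hA : Function.Surjective (algebraMap R A))
    {X Y Z : Type*} [AddCommGroup X] [Module R X] [AddCommGroup Y] [Module R Y]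
    [AddCommGroup Z] [Module R Z] {f : X →ₗ[R] Y} {g : Y →ₗ[R] Z} (hf : Function.Injective f)
    (hfg : Function.Exact f g) (hg : Function.Surjective g)
    (hY : ∀ a : R, algebraMap R A a = 0 → ∀ y : Y, a • y = 0)
    {ι : Type*} [Fintype ι] [DecidableEq ι] (e : Z ≃ₗ[R] (ι → A)) :
    Nonempty (Y ≃ₗ[R] X × Z) := by
  choose y hy using fun i => hg (e.symm (Pi.single i 1))
  let s (i : ι) : A →ₗ[R] Y :=
    (Submodule.liftQ (LinearMap.ker (Algebra.linearMap R A)) (LinearMap.toSpanSingleton R Y (y i))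
      (fun a ha => hY a ha _)) ∘ₗ
      ((Algebra.linearMap R A).quotKerEquivOfSurjective hA).symm.toLinearMap
  have hs (i : ι) (a : R) : s i (algebraMap R A a) = a • y i := by
    have : ((Algebra.linearMap R A).quotKerEquivOfSurjective hA).symm (algebraMap R A a) =
        Submodule.Quotient.mk a := by
      rw [LinearEquiv.symm_apply_eq]
      rfl
    rw [LinearMap.comp_apply, LinearEquiv.coe_coe, this]
    rfl
  refine ⟨((hfg.splitSurjectiveEquiv hf) ⟨LinearMap.lsum R (fun _ => A) R s ∘ₗ e.toLinearMap,
    ?_⟩).1⟩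
  have : g ∘ₗ LinearMap.lsum R (fun _ => A) R s = e.symm.toLinearMap := by
    refine LinearMap.pi_ext fun i b => ?_
    obtain ⟨a, rfl⟩ := hA b
    have hb : (Pi.single i (algebraMap R A a) : ι → A) = a • Pi.single i 1 := by
      rw [← Pi.single_smul, Algebra.smul_def, mul_one]
    rw [LinearMap.comp_apply, LinearMap.lsum_piSingle, hs, map_smul, hy, hb]
    simp
  rw [← LinearMap.comp_assoc, this]
  ext z
  simp

end Split

section FreeHomology

variable {R A : Type} [CommRing R] [CommRing A] [Algebra R A]

lemma annihilator_le_annihilator_quotSMulTop (r : R) (M : Type*) [AddCommGroup M] [Module R M] :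
    Module.annihilator R M ≤ Module.annihilator R (QuotSMulTop r M) :=
  LinearMap.annihilator_le_of_surjective (Submodule.mkQ _) (Submodule.mkQ_surjective _)

lemma nonempty_homology_quotSMulTop_equiv (hA : Function.Surjective (algebraMap R A))
    {M N : Type} [AddCommGroup M] [Module R M]
    [AddCommGroup N] [Module R N] (P : ProjectiveResolution (ModuleCat.of R N)) {c : ℕ}
    (hH : ∀ k, Nonempty ((tensorComplex M P.complex).homology k ≃ₗ[R] (Fin (c.choose k) → A)))
    (hK : RingHom.ker (algebraMap R A) ≤ Module.annihilator R M ⊔ Module.annihilator R N)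
    {r : R} (hr : IsSMulRegular M r) (hrN : ∀ n : N, r • n = 0) (k : ℕ) :
    Nonempty ((tensorComplex (QuotSMulTop r M) P.complex).homology k ≃ₗ[R]
      (Fin ((c + 1).choose k) → A)) := by
  obtain ⟨p, d, hp, hpd, hd, hp0⟩ := exists_homology_tensorComplex_exact hr P.complex
  have hr0 (k : ℕ) (z : (tensorComplex M P.complex).homology k) : r • z = 0 :=
    smul_homology_tensorComplex_eq_zero_of_right P hrN k z
  have hinj (k : ℕ) : Function.Injective (p k) := by
    refine (injective_iff_map_eq_zero _).mpr fun z hz => ?_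
    obtain ⟨w, rfl⟩ := (hp k z).mp hz
    exact hr0 k w
  obtain _ | k := k
  · obtain ⟨e⟩ := hH 0
    rw [Nat.choose_zero_right] at e ⊢
    exact ⟨(LinearEquiv.ofBijective (p 0) ⟨hinj 0, hp0⟩).symm ≪≫ₗ e⟩
  · obtain ⟨e₀⟩ := hH k
    obtain ⟨e₁⟩ := hH (k + 1)
    have hsurj : Function.Surjective (d k) := fun z => (hd k z).mp (hr0 k z)
    obtain ⟨e⟩ := nonempty_linearEquiv_prod_of_exact hA (hinj (k + 1)) (hpd k) hsurj
      (fun a ha y => by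
        obtain ⟨b, hb, b', hb', rfl⟩ := Submodule.mem_sup.mp (hK ha)
        have hb₀ := annihilator_le_annihilator_quotSMulTop r M hb
        rw [add_smul,
          smul_homology_tensorComplex_eq_zero_of_left (Module.mem_annihilator.mp hb₀),
          smul_homology_tensorComplex_eq_zero_of_right P (Module.mem_annihilator.mp hb'), zero_add])
      e₀
    rw [Nat.choose_succ_succ]
    exact ⟨e ≪≫ₗ LinearEquiv.prodComm R _ _ ≪≫ₗ e₀.prodCongr e₁ ≪≫ₗ
      (LinearEquiv.sumArrowLequivProdArrow _ _ R A).symm ≪≫ₗ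
      LinearEquiv.funCongrLeft R A finSumFinEquiv.symm⟩

lemma nonempty_homology_quotient_ofList_equiv (hA : Function.Surjective (algebraMap R A))
    {N : Type} [AddCommGroup N] [Module R N] (P : ProjectiveResolution (ModuleCat.of R N))
    (rs : List R) {M : Type} [AddCommGroup M] [Module R M] {c : ℕ}
    (hH : ∀ k, Nonempty ((tensorComplex M P.complex).homology k ≃ₗ[R] (Fin (c.choose k) → A)))
    (hK : RingHom.ker (algebraMap R A) ≤ Module.annihilator R M ⊔ Module.annihilator R N)
    (hM : RingTheory.Sequence.IsWeaklyRegular M rs) (hN : ∀ r ∈ rs, ∀ n : N, r • n = 0) (k : ℕ) :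
    Nonempty ((tensorComplex (M ⧸ (Ideal.ofList rs • ⊤ : Submodule R M)) P.complex).homology k
      ≃ₗ[R] (Fin ((c + rs.length).choose k) → A)) := by
  induction rs generalizing M c with
  | nil => exact (hH k).map (homologyTensorComplexCongr P (quotientOfListNilEquiv M) k ≪≫ₗ ·)
  | cons r rs ih =>
    rw [RingTheory.Sequence.isWeaklyRegular_cons_iff] at hM
    rw [List.forall_mem_cons] at hN
    rw [List.length_cons, add_comm rs.length, ← add_assoc]
    exact (ih (nonempty_homology_quotSMulTop_equiv hA P hH hK hM.1 hN.1)
      (hK.trans (sup_le_sup_right (annihilator_le_annihilator_quotSMulTop r M) _)) hM.2 hN.2).map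
      (homologyTensorComplexCongr P (Submodule.quotOfListConsSMulTopEquivQuotSMulTopInner M r rs)
        k ≪≫ₗ ·)

end FreeHomology

/-- The quotient by a concatenation of lists is an iterated quotient. -/
noncomputable def quotientOfListAppendEquiv {R : Type*} [CommRing R] (M : Type*) [AddCommGroup M]
    [Module R M] (rs₁ rs₂ : List R) :
    ((M ⧸ (Ideal.ofList rs₁ • ⊤ : Submodule R M)) ⧸
      (Ideal.ofList rs₂ • ⊤ : Submodule R (M ⧸ (Ideal.ofList rs₁ • ⊤ : Submodule R M)))) ≃ₗ[R]
      M ⧸ (Ideal.ofList (rs₁ ++ rs₂) • ⊤ : Submodule R M) :=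
  Submodule.quotEquivOfEq _ _ (by rw [Submodule.map_smul'', Submodule.map_top, Submodule.range_mkQ])
    ≪≫ₗ Submodule.quotientQuotientEquivQuotientSup (Ideal.ofList rs₁ • ⊤) (Ideal.ofList rs₂ • ⊤)
    ≪≫ₗ Submodule.quotEquivOfEq _ _ (by rw [Ideal.ofList_append, Submodule.sup_smul])

/-- Base change of `R ⧸ I` to an `R`-algebra `S` is `S ⧸ IS`. -/
noncomputable def quotientTensorEquivQuotientMap {R : Type*} [CommRing R] (S : Type*) [CommRing S]
    [Algebra R S] (I : Ideal R) :
    (R ⧸ (I • ⊤ : Submodule R R)) ⊗[R] S ≃ₗ[R] S ⧸ I.map (algebraMap R S) :=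
  (Submodule.quotEquivOfEq _ _ (by rw [smul_eq_mul, Ideal.mul_top])).rTensor S ≪≫ₗ
    TensorProduct.quotTensorEquivQuotSMul S I ≪≫ₗ
    Submodule.quotEquivOfEq _ _ (Ideal.smul_top_eq_map I) ≪≫ₗ
    Submodule.Quotient.restrictScalarsEquiv R (I.map (algebraMap R S))

lemma ker_algebraMap_quotient_map_le {R S : Type*} [CommRing R] [CommRing S] [Algebra R S]
    (hsurj : Function.Surjective (algebraMap R S)) (I : Ideal R) :
    RingHom.ker (algebraMap R (S ⧸ I.map (algebraMap R S))) ≤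
      Module.annihilator R (R ⧸ (I • ⊤ : Submodule R R)) ⊔ Module.annihilator R S := by
  intro a ha
  rw [RingHom.mem_ker, IsScalarTower.algebraMap_apply R S (S ⧸ I.map (algebraMap R S)),
    Ideal.Quotient.algebraMap_eq, Ideal.Quotient.eq_zero_iff_mem,
    Ideal.mem_map_iff_of_surjective _ hsurj] at ha
  obtain ⟨b, hb, hab⟩ := ha
  refine Submodule.mem_sup.mpr ⟨b, ?_, a - b, ?_, add_sub_cancel b a⟩
  · rw [smul_eq_mul, Ideal.mul_top]
    exact Ideal.annihilator_quotient.ge hb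
  · refine Module.mem_annihilator.mpr fun s => ?_
    rw [Algebra.smul_def, map_sub, hab, sub_self, zero_mul]

/-- The exterior power of a free module of rank `l`, in coordinates and with restricted scalars. -/
lemma nonempty_restrictScalars_exteriorPower_equiv (R A : Type*) [CommRing R] [CommRing A]
    [Algebra R A] (l k : ℕ) :
    Nonempty ((Fin (l.choose k) → A) ≃ₗ[R] RestrictScalars R A (⋀[A]^k (Fin l → A))) := by
  have hcard : Nat.card (Set.powersetCard (Fin l) k) = l.choose k := by
    rw [Set.powersetCard.card, Nat.card_fin]
  let e : ⋀[A]^k (Fin l → A) ≃ₗ[A] (Fin (l.choose k) → A) :=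
    (((Pi.basisFun A (Fin l)).exteriorPower k).reindex (Finite.equivFinOfCardEq hcard)).equivFun
  exact ⟨{ e.symm.toAddEquiv.trans (RestrictScalars.addEquiv R A (⋀[A]^k (Fin l → A))).symm with
    map_smul' := fun r v => by
      rw [← algebraMap_smul A r v]
      exact e.symm.map_smul (algebraMap R A r) v }⟩

theorem stmt3 (R S : Type) [CommRing R] [CommRing S] [Algebra R S]
    (hsurj : Function.Surjective (algebraMap R S))
    (n m : ℕ) (hmn : m ≤ n) (x : Fin n → R)
    (hreg : RingTheory.Sequence.IsRegular R (List.ofFn x))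
    (I : Ideal R) (hI : I = Ideal.span (Set.range x))
    (hregS : RingTheory.Sequence.IsRegular S
      (List.ofFn fun i : Fin m => algebraMap R S (x (Fin.castLE hmn i))))
    (hzero : ∀ i : Fin n, m ≤ (i : ℕ) → algebraMap R S (x i) = 0)
    (k : ℕ) :
    letI A := S ⧸ (I.map (algebraMap R S))
    Nonempty
      ((((Tor (ModuleCat R) k).obj (ModuleCat.of R (R ⧸ I))).obj (ModuleCat.of R S))
        ≃ₗ[R] RestrictScalars R A (⋀[A]^k (Fin (n - m) → A))) := by
  obtain ⟨l, rfl⟩ := Nat.exists_eq_add_of_le hmn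
  rw [Nat.add_sub_cancel_left]
  have P : ProjectiveResolution (ModuleCat.of R S) := projectiveResolution _
  set rs₁ := List.ofFn fun i : Fin m => x (Fin.castAdd l i) with hrs₁
  set rs₂ := List.ofFn fun i : Fin l => x (Fin.natAdd m i) with hrs₂
  have hrs : List.ofFn x = rs₁ ++ rs₂ := List.ofFn_add
  have hN : ∀ r ∈ rs₂, ∀ s : S, r • s = 0 := by
    intro r hr s
    obtain ⟨i, rfl⟩ := (List.mem_ofFn' _ _).mp hr
    rw [Algebra.smul_def, hzero _ (by simp), zero_mul]
  have hIrs : I = Ideal.ofList (rs₁ ++ rs₂) := by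
    rw [hI, ← hrs, Ideal.ofList]
    congr 1
    ext r
    simp [List.mem_ofFn']
  have hmap : I.map (algebraMap R S) = (Ideal.ofList rs₁).map (algebraMap R S) := by
    rw [hIrs, Ideal.ofList_append, Ideal.map_sup, sup_eq_left, Ideal.map_le_iff_le_comap,
      Ideal.ofList, Ideal.span_le]
    intro r hr
    have h := hN r hr 1
    rw [Algebra.smul_def, mul_one] at h
    rw [SetLike.mem_coe, Ideal.mem_comap, h]
    exact zero_mem _
  rw [hmap]
  set A := S ⧸ (Ideal.ofList rs₁).map (algebraMap R S)
  have hA : Function.Surjective (algebraMap R A) := Ideal.Quotient.mk_surjective.comp hsurj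
  have hwr := hreg.toIsWeaklyRegular
  rw [hrs, RingTheory.Sequence.isWeaklyRegular_append_iff] at hwr
  have hwrS : RingTheory.Sequence.IsWeaklyRegular S rs₁ := by
    rw [← RingTheory.Sequence.isWeaklyRegular_map_algebraMap_iff (S := S), hrs₁, List.map_ofFn]
    exact hregS.toIsWeaklyRegular
  have hacyclic := subsingleton_homology_quotient_ofList P rs₁
    (subsingleton_homology_tensorComplex_self P) hwr.1
    (((TensorProduct.lid R S).isWeaklyRegular_congr rs₁).mpr hwrS)
  have hH (k : ℕ) : Nonempty ((tensorComplex (R ⧸ (Ideal.ofList rs₁ • ⊤ : Submodule R R))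
      P.complex).homology k ≃ₗ[R] (Fin (Nat.choose 0 k) → A)) := by
    obtain _ | k := k
    · exact ⟨homologyZeroEquivTensor P ≪≫ₗ quotientTensorEquivQuotientMap S _ ≪≫ₗ
        (LinearEquiv.funUnique (Fin 1) R A).symm⟩
    · have := hacyclic k
      rw [Nat.choose_zero_succ]
      exact ⟨0⟩
  obtain ⟨e⟩ := nonempty_homology_quotient_ofList_equiv hA P rs₂ hH
    (ker_algebraMap_quotient_map_le hsurj _) hwr.2 hN k
  obtain ⟨e'⟩ := nonempty_restrictScalars_exteriorPower_equiv R A l k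
  rw [zero_add, hrs₂, List.length_ofFn] at e
  have eI : (R ⧸ I) ≃ₗ[R] _ := Submodule.quotEquivOfEq I (Ideal.ofList (rs₁ ++ rs₂) • ⊤)
      (by rw [hIrs, smul_eq_mul, Ideal.mul_top]) ≪≫ₗ (quotientOfListAppendEquiv R rs₁ rs₂).symm
  exact ⟨torEquivHomology P k ≪≫ₗ homologyTensorComplexCongr P eI k ≪≫ₗ e ≪≫ₗ e'⟩
end

section
/- Let R be a commutative ring, I an ideal generated by a regular sequence of length n, and S = R/I. Then Tor^R_k(S, S) ≅ Λ^k_S(I/I²) for all k ≥ 0, where I/I² is a free S-module of rank n. -/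
/-!
STATEMENT 10: Let `R` be a commutative ring, `I` an ideal generated by a regular sequence of
length `n`, and `S = R/I`. Then `Tor^R_k(S, S) ≅ Λ^k_S(I/I²)` for all `k ≥ 0`, where
`I/I² (= I.Cotangent)` is a free `S`-module of rank `n`.
-/

open CategoryTheory

/-- If each `x i` with `i < m` is a nonzerodivisor modulo the previous ones, the coefficients of a
linear relation between `x 0, …, x (m - 1)` lie in the ideal they generate. -/
theorem mem_span_of_sum_mul_eq_zero {R : Type*} [CommRing R] (x : ℕ → R) (m : ℕ)
    (hx : ∀ i < m, ∀ a, x i * a ∈ Ideal.span (x '' (Finset.range i : Set ℕ)) →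
      a ∈ Ideal.span (x '' (Finset.range i : Set ℕ)))
    (a : ℕ → R) (ha : ∑ i ∈ Finset.range m, a i * x i = 0) (i : ℕ) (hi : i < m) :
    a i ∈ Ideal.span (x '' (Finset.range m : Set ℕ)) := by
  induction m generalizing a i with
  | zero => omega
  | succ m ih =>
    have hle : Ideal.span (x '' (Finset.range m : Set ℕ)) ≤
        Ideal.span (x '' (Finset.range (m + 1) : Set ℕ)) :=
      Ideal.span_mono (Set.image_mono (by simp))
    have hxm : x m ∈ Ideal.span (x '' (Finset.range (m + 1) : Set ℕ)) :=
      Ideal.subset_span ⟨m, by simp, rfl⟩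
    rw [Finset.sum_range_succ] at ha
    have ham : a m ∈ Ideal.span (x '' (Finset.range m : Set ℕ)) := by
      refine hx m (by omega) _ ?_
      have : x m * a m = -∑ i ∈ Finset.range m, a i * x i := by linear_combination ha
      rw [this]
      exact neg_mem (sum_mem fun i hi => Ideal.mul_mem_left _ _ (Ideal.subset_span ⟨i, hi, rfl⟩))
    obtain rfl | him := eq_or_ne i m
    · exact hle ham
    obtain ⟨c, hc⟩ := (Submodule.mem_span_image_finset_iff_exists_fun' R).1 ham
    have key := ih (fun i hi => hx i (by omega)) (fun i => a i + c i * x m)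
      (by
        rw [← hc] at ha
        simp only [add_mul, Finset.sum_add_distrib]
        rw [← ha, Finset.sum_mul]
        congr 1
        exact Finset.sum_congr rfl fun i _ => by simp only [smul_eq_mul]; ring) i (by omega)
    have h2 := sub_mem (hle key) (Ideal.mul_mem_left _ (c i) hxm)
    simpa using h2

theorem span_image_getD_range {R : Type*} [CommRing R] (rs : List R) (m : ℕ)
    (hm : m ≤ rs.length) :
    Ideal.span ((fun i => rs.getD i 0) '' (Finset.range m : Set ℕ)) =
      Ideal.ofList (rs.take m) := by
  unfold Ideal.ofList
  congr 1
  ext r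
  simp only [Set.mem_image, Finset.coe_range, Set.mem_Iio, Set.mem_ofPred_eq, List.mem_take_iff_getElem]
  constructor
  · rintro ⟨i, hi, rfl⟩
    exact ⟨i, by omega, by rw [List.getD_eq_getElem _ _ (by omega)]⟩
  · rintro ⟨i, hi, rfl⟩
    exact ⟨i, by omega, by rw [List.getD_eq_getElem _ _ (by omega)]⟩

/-- The classes of a weakly regular sequence generating `I` form a basis of `I ⧸ I ^ 2`. -/
theorem nonempty_basis_cotangent_of_isWeaklyRegular {R : Type*} [CommRing R] (rs : List R)
    (hreg : RingTheory.Sequence.IsWeaklyRegular R rs) :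
    Nonempty (Module.Basis (Fin rs.length) (R ⧸ Ideal.ofList rs) (Ideal.ofList rs).Cotangent) := by
  set I := Ideal.ofList rs with hI
  have hmem (i : Fin rs.length) : rs.getD i 0 ∈ I :=
    Ideal.subset_span (by simp)
  let v (i : Fin rs.length) : I.Cotangent := I.toCotangent ⟨rs.getD i 0, hmem i⟩
  have hspan : I = Ideal.span (Set.range fun i : Fin rs.length => rs.getD i 0) := by
    rw [hI, ← rs.take_length, ← span_image_getD_range rs _ le_rfl, rs.take_length]
    congr 1
    ext r
    simp only [Set.mem_image, Finset.coe_range, Set.mem_Iio, Set.mem_range]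
    exact ⟨fun ⟨i, hi, h⟩ => ⟨⟨i, hi⟩, h⟩, fun ⟨i, h⟩ => ⟨i, i.2, h⟩⟩
  have hcomb (a : Fin rs.length → R) :
      ∑ i, Ideal.Quotient.mk I (a i) • v i = I.toCotangent
        ⟨∑ i, a i * rs.getD i 0, sum_mem fun i _ => I.mul_mem_left _ (hmem i)⟩ := by
    have : (⟨∑ i, a i * rs.getD i 0, sum_mem fun i _ => I.mul_mem_left _ (hmem i)⟩ : I) =
        ∑ i, a i • ⟨rs.getD i 0, hmem i⟩ := by ext; simp
    rw [this, map_sum]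
    simp only [map_smul]
    rfl
  refine ⟨Module.Basis.mk (v := v) ?_ ?_⟩
  · rw [Fintype.linearIndependent_iff]
    intro g hg i
    choose a ha using fun i => Ideal.Quotient.mk_surjective (g i)
    simp only [← ha] at hg ⊢
    rw [hcomb, Ideal.toCotangent_eq_zero, pow_two] at hg
    nth_rw 2 [hspan] at hg
    obtain ⟨b, hb, hsum⟩ := (Submodule.mem_ideal_smul_span_iff_exists_sum I _ _).1 hg
    rw [Finsupp.sum_fintype _ _ (by simp)] at hsum
    rw [Ideal.Quotient.eq_zero_iff_mem]
    have key := mem_span_of_sum_mul_eq_zero (fun i => rs.getD i 0) rs.length ?_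
      (fun j => if h : j < rs.length then a ⟨j, h⟩ - b ⟨j, h⟩ else 0) ?_ i i.2
    · rw [span_image_getD_range _ _ le_rfl, List.take_length] at key
      simpa using add_mem key (hb i)
    · intro j hj r hr
      rw [span_image_getD_range _ _ hj.le] at hr ⊢
      have := hreg.regular_mod_prev j hj
      rw [isSMulRegular_iff_right_eq_zero_of_smul] at this
      have := this (Submodule.Quotient.mk r)
      rw [← Submodule.Quotient.mk_smul, Submodule.Quotient.mk_eq_zero,
        Submodule.Quotient.mk_eq_zero] at this
      simp only [smul_eq_mul, Ideal.mul_top] at this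
      refine this ?_
      rwa [List.getD_eq_getElem _ _ hj] at hr
    · rw [Finset.sum_range]
      simp only [Fin.is_lt, dite_true, Fin.eta, sub_mul, Finset.sum_sub_distrib]
      exact sub_eq_zero.2 hsum.symm
  · rintro y -
    obtain ⟨⟨y, hy⟩, rfl⟩ := I.toCotangent_surjective y
    have hy' := hy
    rw [hspan] at hy'
    obtain ⟨a, ha⟩ := (Submodule.mem_span_range_iff_exists_fun R).1 hy'
    have : I.toCotangent ⟨y, hy⟩ = ∑ i, Ideal.Quotient.mk I (a i) • v i := by
      rw [hcomb]
      congr 2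
      exact ha.symm
    rw [this]
    exact sum_mem fun i _ => Submodule.smul_mem _ _ (Submodule.subset_span ⟨i, rfl⟩)

/-- An extension of finite free `R ⧸ I`-modules which is killed by `I` is free. -/
theorem nonempty_linearEquiv_pi_of_exact {R : Type*} [CommRing R] (I : Ideal R)
    {M₁ M₂ M₃ : Type*} [AddCommGroup M₁] [AddCommGroup M₂] [AddCommGroup M₃]
    [Module R M₁] [Module R M₂] [Module R M₃] (f : M₁ →ₗ[R] M₂) (g : M₂ →ₗ[R] M₃)
    (hf : Function.Injective f) (hg : Function.Surjective g) (hfg : Function.Exact f g)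
    (hI : ∀ r ∈ I, ∀ y : M₂, r • y = 0) {a b : ℕ}
    (e₁ : Nonempty (M₁ ≃ₗ[R] (Fin a → R ⧸ I))) (e₃ : Nonempty (M₃ ≃ₗ[R] (Fin b → R ⧸ I))) :
    Nonempty (M₂ ≃ₗ[R] (Fin (a + b) → R ⧸ I)) := by
  obtain ⟨e₁⟩ := e₁
  obtain ⟨e₃⟩ := e₃
  choose m hm using fun i => hg (e₃.symm (Pi.single i 1))
  let s : (Fin b → R ⧸ I) →ₗ[R] M₂ := LinearMap.lsum R (fun _ => R ⧸ I) R fun i =>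
    Submodule.liftQ I (LinearMap.toSpanSingleton R M₂ (m i)) fun r hr => by
      simpa using hI r hr (m i)
  have hs : g ∘ₗ s = e₃.symm.toLinearMap := by
    ext i
    have hsi : s (Pi.single i (Ideal.Quotient.mk I 1)) = m i := by
      rw [LinearMap.lsum_piSingle]
      exact (Submodule.liftQ_apply _ _ _).trans (by simp)
    simpa [hm] using congrArg g hsi
  have hs' : g ∘ₗ (s ∘ₗ e₃.toLinearMap) = LinearMap.id := by
    rw [← LinearMap.comp_assoc, hs]
    ext; simp
  obtain ⟨e, -⟩ := hfg.splitSurjectiveEquiv hf ⟨_, hs'⟩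
  exact ⟨e ≪≫ₗ e₁.prodCongr e₃ ≪≫ₗ (LinearEquiv.sumArrowLequivProdArrow _ _ R _).symm ≪≫ₗ
    LinearEquiv.funCongrLeft R _ finSumFinEquiv.symm⟩

theorem HomologicalComplex.homologyMap_smul {R C ι : Type*} [Semiring R] [Category* C]
    [Preadditive C] [Linear R C] {c : ComplexShape ι} {K L : HomologicalComplex C c}
    (r : R) (f : K ⟶ L) (i : ι) [K.HasHomology i] [L.HasHomology i] :
    homologyMap (r • f) i = r • homologyMap f i :=
  ShortComplex.homologyMap_smul ((shortComplexFunctor C c i).map f) r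

universe u

namespace ModuleCat

open MonoidalCategory

variable {R : Type u} [CommRing R]

/-- The functor `X ↦ X ⊗ K` for a chain complex `K` of modules. -/
noncomputable def tensorComplex (K : ChainComplex (ModuleCat.{u} R) ℕ) :
    ModuleCat.{u} R ⥤ ChainComplex (ModuleCat.{u} R) ℕ where
  obj X := (((tensoringLeft (ModuleCat.{u} R)).obj X).mapHomologicalComplex _).obj K
  map f := (NatTrans.mapHomologicalComplex ((tensoringLeft (ModuleCat.{u} R)).map f) _).app K
  map_id X := by ext : 1; simp
  map_comp f g := by ext : 1; simp

/-- Tensoring `0 → X → X → X ⧸ r X → 0` with a complex of flat modules is short exact. -/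
theorem tensorComplex_shortExact (K : ChainComplex (ModuleCat.{u} R) ℕ)
    (hK : ∀ i, Module.Flat R (K.X i)) (X : ModuleCat.{u} R) (r : R) (hr : IsSMulRegular X r) :
    ∃ (w : (tensorComplex K).map (X.smulShortComplex r).f ≫
        (tensorComplex K).map (X.smulShortComplex r).g = 0),
      (ShortComplex.mk _ _ w).ShortExact := by
  have hs := hr.smulShortComplex_shortExact
  have hex := (ShortComplex.ShortExact.moduleCat_exact_iff_function_exact _).1 hs.exact
  have hinj := hs.moduleCat_injective_f
  have hsurj := hs.moduleCat_surjective_g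
  have w : (tensorComplex K).map (X.smulShortComplex r).f ≫
        (tensorComplex K).map (X.smulShortComplex r).g = 0 := by
    rw [← Functor.map_comp, (X.smulShortComplex r).zero]
    ext i : 1
    exact MonoidalPreadditive.zero_whiskerRight ..
  refine ⟨w, HomologicalComplex.shortExact_of_degreewise_shortExact _ fun i => ?_⟩
  have := hK i
  refine ShortComplex.ShortExact.mk' ?_ ?_ ?_
  · rw [ShortComplex.ShortExact.moduleCat_exact_iff_function_exact]
    exact rTensor_exact (K.X i) hex hsurj
  · rw [ModuleCat.mono_iff_injective]
    exact Module.Flat.rTensor_preserves_injective_linearMap (M := K.X i) _ hinj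
  · rw [ModuleCat.epi_iff_surjective]
    exact LinearMap.rTensor_surjective (K.X i) hsurj

/-- The homology of `X ⊗ P`, for `P` a projective resolution of `Y`, is killed by the annihilator
of `Y`. -/
theorem smul_homology_tensorComplex_eq_zero {Y : ModuleCat.{u} R} (P : ProjectiveResolution Y)
    (r : R) (hr : ∀ y : Y, r • y = 0) (X : ModuleCat.{u} R) (k : ℕ)
    (z : ((tensorComplex P.complex).obj X).homology k) : r • z = 0 := by
  let h : Homotopy (r • 𝟙 P.complex) 0 := ProjectiveResolution.liftHomotopyZero _ (by
    have : r • 𝟙 Y = 0 := by ext y; exact hr y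
    rw [Linear.smul_comp, Category.id_comp]
    apply HomologicalComplex.to_single_hom_ext
    ext x
    exact hr _)
  have h2 := (((tensoringLeft (ModuleCat.{u} R)).obj X).mapHomotopy h).homologyMap_eq k
  have h3 : (((tensoringLeft (ModuleCat.{u} R)).obj X).mapHomologicalComplex _).map
      (r • 𝟙 P.complex) = r • 𝟙 ((tensorComplex P.complex).obj X) := by
    ext i : 1
    change X ◁ (r • 𝟙 (P.complex.X i)) = r • 𝟙 (X ⊗ P.complex.X i)
    simp
  have h4 : HomologicalComplex.homologyMap (r • 𝟙 ((tensorComplex P.complex).obj X)) k =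
      r • 𝟙 _ := by
    rw [HomologicalComplex.homologyMap_smul, HomologicalComplex.homologyMap_id]
  have h5 : HomologicalComplex.homologyMap (r • 𝟙 ((tensorComplex P.complex).obj X)) k = 0 :=
    (congrArg (fun f => HomologicalComplex.homologyMap f k) h3.symm).trans
      (h2.trans (by rw [Functor.map_zero, HomologicalComplex.homologyMap_zero]; rfl))
  exact congrArg (fun f => f.hom z) (h4.symm.trans h5)

/-- `Tor_k(R, R ⧸ I)` is `R ⧸ I` for `k = 0` and vanishes otherwise. -/
theorem nonempty_homology_tensorComplex_self {Y : ModuleCat.{u} R} (P : ProjectiveResolution Y)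
    (k : ℕ) {I : Ideal R} (e : Y ≃ₗ[R] R ⧸ I) :
    Nonempty (((tensorComplex P.complex).obj (of R R)).homology k ≃ₗ[R]
      (Fin (Nat.choose 0 k) → R ⧸ I)) := by
  let e₁ : (tensorComplex P.complex).obj (of R R) ≅ P.complex :=
    (NatIso.mapHomologicalComplex (leftUnitorNatIso (ModuleCat.{u} R)) _).app P.complex ≪≫
      (Functor.mapHomologicalComplexIdIso _ _).app P.complex
  have hπ : IsIso (HomologicalComplex.homologyMap P.π k) :=
    (quasiIsoAt_iff_isIso_homologyMap P.π k).1 inferInstance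
  let e₂ := (HomologicalComplex.homologyFunctor _ _ k).mapIso e₁ ≪≫
    @asIso _ _ _ _ _ hπ
  cases k with
  | zero =>
    let e₃ := e₂ ≪≫ HomologicalComplex.singleObjHomologySelfIso _ 0 Y
    exact ⟨e₃.toLinearEquiv ≪≫ₗ e ≪≫ₗ (LinearEquiv.funUnique (Fin 1) R (R ⧸ I)).symm⟩
  | succ k =>
    have h := (HomologicalComplex.isZero_single_obj_homology (ComplexShape.down ℕ) 0 Y (k + 1)
      (by simp)).of_iso e₂
    have := ModuleCat.subsingleton_of_isZero h
    have hsub : Subsingleton (Fin (Nat.choose 0 (k + 1)) → R ⧸ I) := by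
      rw [Nat.choose_zero_succ]; infer_instance
    exact ⟨LinearEquiv.ofBijective 0 ⟨fun _ _ _ => this.elim _ _, fun _ => ⟨0, Subsingleton.elim _ _⟩⟩⟩

/-- If `Tor_k(X, Y)` is free of rank `m.choose k` over `R ⧸ I` for all `k`, then `Tor_k(X ⧸ r X, Y)` is
free of rank `(m + 1).choose k` for every `X`-regular `r ∈ I`. -/
theorem nonempty_homology_tensorComplex_quotSMulTop {I : Ideal R} {Y : ModuleCat.{u} R}
    (hY : ∀ r ∈ I, ∀ y : Y, r • y = 0) (P : ProjectiveResolution Y)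
    (X : ModuleCat.{u} R) (r : R) (hr : IsSMulRegular X r) (hrI : r ∈ I) (m : ℕ)
    (e : ∀ k, Nonempty (((tensorComplex P.complex).obj X).homology k ≃ₗ[R]
      (Fin (m.choose k) → R ⧸ I))) (k : ℕ) :
    Nonempty (((tensorComplex P.complex).obj (of R (QuotSMulTop r X))).homology k ≃ₗ[R]
      (Fin ((m + 1).choose k) → R ⧸ I)) := by
  have hflat (i : ℕ) : Module.Flat R (P.complex.X i) := by
    have : Module.Projective R (P.complex.X i) :=
      (IsProjective.iff_projective _).2 (P.projective i)
    infer_instance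
  obtain ⟨w, hS⟩ := tensorComplex_shortExact P.complex hflat X r hr
  have hzero (k : ℕ) : HomologicalComplex.homologyMap
      ((tensorComplex P.complex).map (X.smulShortComplex r).f) k = 0 := by
    have h1 : (tensorComplex P.complex).map (X.smulShortComplex r).f =
        r • 𝟙 ((tensorComplex P.complex).obj X) := by
      ext i : 1
      change (r • 𝟙 X) ▷ (P.complex.X i) = r • 𝟙 (X ⊗ P.complex.X i)
      simp
    have h2 : HomologicalComplex.homologyMap (r • 𝟙 ((tensorComplex P.complex).obj X)) k =
        r • 𝟙 _ := by
      rw [HomologicalComplex.homologyMap_smul, HomologicalComplex.homologyMap_id]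
    refine (congrArg (fun f => HomologicalComplex.homologyMap f k) h1).trans (h2.trans ?_)
    ext z
    exact smul_homology_tensorComplex_eq_zero P r (hY r hrI) X k z
  have hmono (k : ℕ) : Mono (HomologicalComplex.homologyMap
      ((tensorComplex P.complex).map (X.smulShortComplex r).g) k) :=
    (hS.homology_exact₂ k).mono_g (hzero k)
  cases k with
  | zero =>
    have := hS.epi_g
    have hepi : Epi (HomologicalComplex.homologyMap
        ((tensorComplex P.complex).map (X.smulShortComplex r).g) 0) :=
      HomologicalComplex.epi_homologyMap_of_epi_of_not_rel _ _ (by simp)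
    have := isIso_of_mono_of_epi (HomologicalComplex.homologyMap
        ((tensorComplex P.complex).map (X.smulShortComplex r).g) 0)
    obtain ⟨e₀⟩ := e 0
    rw [Nat.choose_zero_right] at e₀ ⊢
    exact ⟨(asIso (HomologicalComplex.homologyMap
        ((tensorComplex P.complex).map (X.smulShortComplex r).g) 0)).toLinearEquiv.symm ≪≫ₗ e₀⟩
  | succ k =>
    have hepi : Epi (hS.δ (k + 1) k rfl) := (hS.homology_exact₁ (k + 1) k rfl).epi_f (hzero k)
    rw [Nat.choose_succ_succ', Nat.add_comm (m.choose k)]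
    exact nonempty_linearEquiv_pi_of_exact I _ _
      ((ModuleCat.mono_iff_injective _).1 (hmono (k + 1)))
      ((ModuleCat.epi_iff_surjective _).1 hepi)
      ((ShortComplex.ShortExact.moduleCat_exact_iff_function_exact _).1
        (hS.homology_exact₃ (k + 1) k rfl))
      (fun s hs y => smul_homology_tensorComplex_eq_zero P s (hY s hs) _ _ y) (e (k + 1)) (e k)

/-- If `Tor_k(X, Y)` is free of rank `m.choose k` over `R ⧸ I` for all `k`, then
`Tor_k(X ⧸ (rs) X, Y)` is free of rank `(m + rs.length).choose k` for every weakly `X`-regular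
sequence `rs` in `I`. -/
theorem nonempty_homology_tensorComplex_quot_ofList {I : Ideal R} {Y : ModuleCat.{u} R}
    (hY : ∀ r ∈ I, ∀ y : Y, r • y = 0) (P : ProjectiveResolution Y) (rs : List R)
    (hrs : ∀ r ∈ rs, r ∈ I) (X : ModuleCat.{u} R)
    (hreg : RingTheory.Sequence.IsWeaklyRegular X rs) (m : ℕ)
    (e : ∀ k, Nonempty (((tensorComplex P.complex).obj X).homology k ≃ₗ[R]
      (Fin (m.choose k) → R ⧸ I))) (k : ℕ) :
    Nonempty (((tensorComplex P.complex).obj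
        (of R (X ⧸ (Ideal.ofList rs • ⊤ : Submodule R X)))).homology k ≃ₗ[R]
      (Fin ((m + rs.length).choose k) → R ⧸ I)) := by
  induction rs generalizing X m with
  | nil =>
    obtain ⟨e⟩ := e k
    let e₁ : (X ⧸ (Ideal.ofList ([] : List R) • ⊤ : Submodule R X)) ≃ₗ[R] X :=
      Submodule.quotEquivOfEqBot _ (by simp)
    exact ⟨((tensorComplex P.complex ⋙ HomologicalComplex.homologyFunctor _ _ k).mapIso
      e₁.toModuleIso).toLinearEquiv ≪≫ₗ e⟩
  | cons r rs ih =>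
    rw [RingTheory.Sequence.isWeaklyRegular_cons_iff] at hreg
    obtain ⟨e'⟩ := ih (fun s hs => hrs s (List.mem_cons_of_mem _ hs)) (of R (QuotSMulTop r X))
      hreg.2 (m + 1) (nonempty_homology_tensorComplex_quotSMulTop hY P X r hreg.1
        (hrs r List.mem_cons_self) m e)
    let e₁ := Submodule.quotOfListConsSMulTopEquivQuotSMulTopInner X r rs
    rw [List.length_cons, Nat.add_comm rs.length, ← Nat.add_assoc]
    exact ⟨((tensorComplex P.complex ⋙ HomologicalComplex.homologyFunctor _ _ k).mapIso
      e₁.toModuleIso).toLinearEquiv ≪≫ₗ e'⟩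

end ModuleCat

theorem stmt10 (R : Type) [CommRing R] (n : ℕ) (rs : List R) (hlen : rs.length = n)
    (hreg : RingTheory.Sequence.IsRegular R rs)
    (I : Ideal R) (hI : I = Ideal.ofList rs) (k : ℕ) :
    letI S := R ⧸ I
    Nonempty (I.Cotangent ≃ₗ[S] (Fin n → S)) ∧
    Nonempty
      ((((Tor (ModuleCat R) k).obj (ModuleCat.of R (R ⧸ I))).obj (ModuleCat.of R (R ⧸ I)))
        ≃ₗ[R] RestrictScalars R (R ⧸ I) (⋀[R ⧸ I]^k I.Cotangent)) := by
  subst hlen hI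
  obtain ⟨b⟩ := nonempty_basis_cotangent_of_isWeaklyRegular rs hreg.toIsWeaklyRegular
  refine ⟨⟨b.equivFun⟩, ?_⟩
  set I := Ideal.ofList rs with hI
  have hcard : Fintype.card (Set.powersetCard (Fin rs.length) k) = rs.length.choose k := by
    rw [Fintype.card_eq_nat_card, Set.powersetCard.card, Nat.card_fin]
  let c := (b.exteriorPower k).reindex (Fintype.equivFinOfCardEq hcard)
  let P := projectiveResolution (ModuleCat.of R (R ⧸ I))
  have hY (r : R) (hr : r ∈ I) (y : ModuleCat.of R (R ⧸ I)) : r • y = 0 := by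
    obtain ⟨y, rfl⟩ := Ideal.Quotient.mk_surjective y
    exact Ideal.Quotient.eq_zero_iff_mem.2 (I.mul_mem_right y hr)
  obtain ⟨e⟩ := ModuleCat.nonempty_homology_tensorComplex_quot_ofList hY P rs
    (fun r hr => Ideal.subset_span hr) (ModuleCat.of R R) hreg.toIsWeaklyRegular 0
    (fun k => ModuleCat.nonempty_homology_tensorComplex_self P k (LinearEquiv.refl R _)) k
  rw [Nat.zero_add] at e
  let e₁ : (R ⧸ I) ≃ₗ[R] (R ⧸ (I • ⊤ : Submodule R R)) := Submodule.quotEquivOfEq _ _ (by simp)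
  let e₂ := ((ModuleCat.tensorComplex P.complex ⋙
    HomologicalComplex.homologyFunctor _ _ k).mapIso e₁.toModuleIso).toLinearEquiv
  let e₃ := (P.isoLeftDerivedObj
    ((MonoidalCategory.tensoringLeft (ModuleCat R)).obj (ModuleCat.of R (R ⧸ I))) k).toLinearEquiv
  let e₄ : RestrictScalars R (R ⧸ I) (⋀[R ⧸ I]^k I.Cotangent) ≃ₗ[R]
      (Fin (rs.length.choose k) → R ⧸ I) :=
    { (RestrictScalars.addEquiv R (R ⧸ I) (⋀[R ⧸ I]^k I.Cotangent)).trans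
        c.equivFun.toAddEquiv with
      map_smul' := fun r x => by
        refine (congrArg c.equivFun (?_ : _ = Ideal.Quotient.mk I r •
          RestrictScalars.addEquiv R (R ⧸ I) (⋀[R ⧸ I]^k I.Cotangent) x)).trans ?_
        · exact RestrictScalars.addEquiv_map_smul ..
        · exact map_smul .. }
  exact ⟨e₃ ≪≫ₗ e₂ ≪≫ₗ e ≪≫ₗ e₄.symm⟩
end
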